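/- arXiv:2001.01564 — 3 statements merged into one kernel-verified Lean document; each statement's English description precedes it below -/
import Mathlib

section
/- Let n ≥ 1 and d ≥ 1 be integers, R̂ an n×n real symmetric positive semidefinite matrix, and G an n×n real matrix such that the 2n×2n block matrix [[R̂, G],[Gᵀ, R̂]] is positive semidefinite. Let τ > 0 and λ₀, λ₁, …, λ_d be positive real numbers with λ₀ + λ₁ + ⋯ + λ_d = τ, and let δ₀, δ₁, …, δ_d ∈ ℝⁿ. Then τ · Σ_{v=0}^{d} (1/λᵥ) · δᵥᵀ R̂ δᵥ ≥ Σ_{v=0}^{d} δᵥᵀ R̂ δᵥ + Σ_{0 ≤ v < w ≤ d} δᵥᵀ (G + Gᵀ) δ_w. -/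
open Matrix

/-- A double sum splits into its diagonal and the symmetrized sum over ordered pairs. -/
theorem sum_sum_eq_sum_diag_add_sum_lt {ι M : Type*} [Fintype ι] [LinearOrder ι]
    [AddCommMonoid M] (f : ι → ι → M) :
    ∑ v, ∑ w, f v w = ∑ v, f v v + ∑ v, ∑ w, (if v < w then f v w + f w v else 0) := by
  have hsplit : ∀ v w, f v w = (if v = w then f v w else 0) +
      ((if v < w then f v w else 0) + (if w < v then f v w else 0)) := by
    intro v w
    rcases lt_trichotomy v w with h | rfl | h
    · simp [h, h.ne, h.not_gt]
    · simp
    · simp [h, h.ne', h.not_gt]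
  have hpair : ∀ v w, (if v < w then f v w + f w v else 0) =
      (if v < w then f v w else 0) + (if v < w then f w v else 0) := by
    intro v w
    split_ifs <;> simp
  calc ∑ v, ∑ w, f v w
      = ∑ v, f v v + (∑ v, ∑ w, (if v < w then f v w else 0) +
          ∑ v, ∑ w, (if w < v then f v w else 0)) := by
        rw [Finset.sum_congr rfl fun v _ => Finset.sum_congr rfl fun w _ => hsplit v w]
        simp [Finset.sum_add_distrib]
    _ = _ := by
        rw [Finset.sum_comm (f := fun v w => if w < v then f v w else 0)]
        simp only [hpair, Finset.sum_add_distrib]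

/-- Weighted Young inequality for the off-diagonal block of a positive semidefinite matrix. -/
theorem Matrix.PosSemidef.two_mul_dotProduct_le_of_fromBlocks {ι : Type*} [Fintype ι]
    {R G : Matrix ι ι ℝ} (h : (Matrix.fromBlocks R G Gᵀ R).PosSemidef)
    {s t : ℝ} (hs : 0 < s) (ht : 0 < t) (x y : ι → ℝ) :
    2 * (x ⬝ᵥ (G *ᵥ y)) ≤ t / s * (x ⬝ᵥ (R *ᵥ x)) + s / t * (y ⬝ᵥ (R *ᵥ y)) := by
  have hq := h.dotProduct_mulVec_nonneg (Sum.elim (t • x) (-(s • y)))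
  simp only [star_trivial, Matrix.fromBlocks_mulVec, Sum.elim_comp_inl, Sum.elim_comp_inr,
    sumElim_dotProduct_sumElim, Matrix.mulVec_neg, Matrix.mulVec_smul, dotProduct_add,
    dotProduct_neg, neg_dotProduct, dotProduct_smul, smul_dotProduct, smul_eq_mul,
    dotProduct_transpose_mulVec] at hq
  have hst : 0 < s * t := mul_pos hs ht
  have heq : t / s * (x ⬝ᵥ (R *ᵥ x)) + s / t * (y ⬝ᵥ (R *ᵥ y)) =
      (t * t * (x ⬝ᵥ (R *ᵥ x)) + s * s * (y ⬝ᵥ (R *ᵥ y))) / (s * t) := by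
    field_simp
  rw [heq, le_div_iff₀ hst]
  linarith

/-- Lemma 3 (reciprocally convex combination inequality): if `[[R̂,G],[Gᵀ,R̂]] ⪰ 0`,
`λ₀ + ⋯ + λ_d = τ` with `λᵥ > 0`, then
`τ Σᵥ (1/λᵥ) δᵥᵀR̂δᵥ ≥ Σᵥ δᵥᵀR̂δᵥ + Σ_{v<w} δᵥᵀ(G+Gᵀ)δ_w`. -/
theorem stmt_2 (n d : ℕ) (hn : 0 < n) (hd : 0 < d)
    (Rh : Matrix (Fin n) (Fin n) ℝ) (hRh : Rh.PosSemidef)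
    (G : Matrix (Fin n) (Fin n) ℝ)
    (hblk : (Matrix.fromBlocks Rh G Gᵀ Rh).PosSemidef)
    (τ : ℝ) (hτ : 0 < τ) (lam : Fin (d + 1) → ℝ) (hlam : ∀ v, 0 < lam v)
    (hsum : ∑ v, lam v = τ) (δ : Fin (d + 1) → (Fin n → ℝ)) :
    (∑ v, δ v ⬝ᵥ (Rh *ᵥ δ v)) +
        ∑ v, ∑ w, (if v < w then δ v ⬝ᵥ ((G + Gᵀ) *ᵥ δ w) else 0) ≤
      τ * ∑ v, (1 / lam v) * (δ v ⬝ᵥ (Rh *ᵥ δ v)) := by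
  have hrhs : τ * ∑ v, (1 / lam v) * (δ v ⬝ᵥ (Rh *ᵥ δ v)) =
      ∑ v, ∑ w, lam w / lam v * (δ v ⬝ᵥ (Rh *ᵥ δ v)) := by
    rw [← hsum, Finset.mul_sum]
    refine Finset.sum_congr rfl fun v _ => ?_
    rw [← Finset.sum_mul, ← Finset.sum_div]
    ring
  rw [hrhs, sum_sum_eq_sum_diag_add_sum_lt
    fun v w => lam w / lam v * (δ v ⬝ᵥ (Rh *ᵥ δ v))]
  refine add_le_add ?_ ?_
  · refine Finset.sum_le_sum fun v _ => ?_
    rw [div_self (hlam v).ne', one_mul]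
  · refine Finset.sum_le_sum fun v _ => Finset.sum_le_sum fun w _ => ?_
    split_ifs
    · have hvw := hblk.two_mul_dotProduct_le_of_fromBlocks (hlam v) (hlam w) (δ v) (δ w)
      have hwv := hblk.two_mul_dotProduct_le_of_fromBlocks (hlam w) (hlam v) (δ w) (δ v)
      rw [Matrix.add_mulVec, dotProduct_add, dotProduct_transpose_mulVec]
      linarith
    · exact le_rfl
end

section
/- Let m ≤ n be positive integers with l = n − m, B an n×m real matrix, and T, T̂ invertible n×n real matrices such that T·B = [Iₘ; 0] and T̂·B = [Iₘ; 0]. Then for every m×m real matrix U, every l×m real matrix L₂₁, and every l×l real matrix L₂₂, there exist an l×m real matrix L̂₂₁ and an l×l real matrix L̂₂₂ such that, setting L = [[U, 0],[L₂₁, L₂₂]] and L̂ = [[U, 0],[L̂₂₁, L̂₂₂]], one has LᵀT = L̂ᵀT̂. In particular, the block lower-triangular structure with the same top-left block U is preserved when changing T to T̂. -/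
open Matrix

/-- Change of reduction matrix (Theorem 3, key step): if `T·B = [Iₘ;0] = T̂·B` with
`T, T̂` invertible, then for any structured `L = [[U,0],[L₂₁,L₂₂]]` there exist `L̂₂₁, L̂₂₂`
such that, with `L̂ = [[U,0],[L̂₂₁,L̂₂₂]]`, one has `LᵀT = L̂ᵀT̂`. -/
theorem stmt_12 (m l : ℕ) (hm : 0 < m) (hl : 0 < l)
    (B : Matrix (Fin m ⊕ Fin l) (Fin m) ℝ)
    (T That : Matrix (Fin m ⊕ Fin l) (Fin m ⊕ Fin l) ℝ)
    (hT : IsUnit T.det) (hThat : IsUnit That.det)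
    (hTB : T * B = Matrix.fromRows (1 : Matrix (Fin m) (Fin m) ℝ)
      (0 : Matrix (Fin l) (Fin m) ℝ))
    (hThatB : That * B = Matrix.fromRows (1 : Matrix (Fin m) (Fin m) ℝ)
      (0 : Matrix (Fin l) (Fin m) ℝ))
    (U : Matrix (Fin m) (Fin m) ℝ) (L21 : Matrix (Fin l) (Fin m) ℝ)
    (L22 : Matrix (Fin l) (Fin l) ℝ) :
    ∃ (L21h : Matrix (Fin l) (Fin m) ℝ) (L22h : Matrix (Fin l) (Fin l) ℝ),
      (Matrix.fromBlocks U 0 L21 L22)ᵀ * T =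
        (Matrix.fromBlocks U 0 L21h L22h)ᵀ * That := by
  set X := (fromBlocks U 0 L21 L22)ᵀ * T * That⁻¹ with hX
  have hXThat : X * That = (fromBlocks U 0 L21 L22)ᵀ * T := by
    rw [hX, Matrix.mul_assoc, nonsing_inv_mul _ hThat, Matrix.mul_one]
  have hcol : X * fromRows (1 : Matrix (Fin m) (Fin m) ℝ) (0 : Matrix (Fin l) (Fin m) ℝ) =
      fromRows Uᵀ 0 := by
    rw [← hThatB, ← Matrix.mul_assoc, hXThat, Matrix.mul_assoc, hTB, fromBlocks_transpose,
      fromBlocks_mul_fromRows]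
    simp
  rw [← fromBlocks_toBlocks X, fromBlocks_mul_fromRows] at hcol
  obtain ⟨h11, h21⟩ := fromRows_inj hcol
  simp only [Matrix.mul_one, Matrix.mul_zero, add_zero] at h11 h21
  refine ⟨X.toBlocks₁₂ᵀ, X.toBlocks₂₂ᵀ, ?_⟩
  rw [← hXThat, fromBlocks_transpose, transpose_transpose, transpose_transpose, transpose_zero,
    ← h11, ← h21, fromBlocks_toBlocks]
end

section
/- Let n be a positive integer, α a real number, τ > 0, P, Q, R real symmetric n×n matrices, and x : ℝ → ℝⁿ a continuously differentiable function. Define the Lyapunov–Krasovskii functional V : ℝ → ℝ by V(t) = x(t)ᵀ P x(t) + ∫_{t−τ}^{t} e^{2α(s−t)} x(s)ᵀ Q x(s) ds + τ · ∫_{−τ}^{0} ∫_{t+θ}^{t} e^{2α(s−t)} x′(s)ᵀ R x′(s) ds dθ. Then V is differentiable and, for every t, V′(t) + 2α·V(t) = 2·x(t)ᵀ P x′(t) + x(t)ᵀ(2αP + Q)x(t) + τ²·x′(t)ᵀ R x′(t) − e^{−2ατ}·x(t−τ)ᵀ Q x(t−τ) − τ·∫_{t−τ}^{t} e^{2α(s−t)}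 x′(s)ᵀ R x′(s) ds. -/
open Matrix

open intervalIntegral in
/-- The exponential weight `e^{c(s-t)}` splits off a factor depending only on `t`. -/
theorem integral_exp_sub_mul_eq {g : ℝ → ℝ} (hg : Continuous g) (c t a b : ℝ) :
    ∫ s in a..b, Real.exp (c * (s - t)) * g s =
      Real.exp (-(c * t)) * ((∫ s in (0 : ℝ)..b, Real.exp (c * s) * g s) -
        ∫ s in (0 : ℝ)..a, Real.exp (c * s) * g s) := by
  have hh : Continuous fun s => Real.exp (c * s) * g s := by fun_prop
  rw [integral_interval_sub_left (hh.intervalIntegrable _ _) (hh.intervalIntegrable _ _),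
    ← integral_const_mul]
  refine integral_congr fun s _ => ?_
  simp only [← mul_assoc, ← Real.exp_add]
  ring_nf

theorem hasDerivAt_exp_neg_mul (c t : ℝ) :
    HasDerivAt (fun u => Real.exp (-(c * u))) (-c * Real.exp (-(c * t))) t := by
  have h : HasDerivAt (fun u => -(c * u)) (-c) t := by
    simpa using ((hasDerivAt_id t).const_mul c).fun_neg
  exact h.exp.congr_deriv (mul_comm _ _)

/-- Derivative of an exponentially weighted integral over a sliding window. -/
theorem hasDerivAt_integral_exp_window {g : ℝ → ℝ} (hg : Continuous g) (c τ t : ℝ) :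
    HasDerivAt (fun u => ∫ s in (u - τ)..u, Real.exp (c * (s - u)) * g s)
      (g t - Real.exp (-(c * τ)) * g (t - τ) -
        c * ∫ s in (t - τ)..t, Real.exp (c * (s - t)) * g s) t := by
  have hh : Continuous fun s => Real.exp (c * s) * g s := by fun_prop
  have hF (u : ℝ) := hh.integral_hasStrictDerivAt 0 u |>.hasDerivAt
  have key := (hasDerivAt_exp_neg_mul c t).mul
    ((hF t).sub ((hF (t - τ)).comp_sub_const t τ))
  simp only [integral_exp_sub_mul_eq hg c]
  refine key.congr_deriv ?_
  have e₁ : Real.exp (-(c * t)) * Real.exp (c * t) = 1 := by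
    rw [← Real.exp_add]; simp
  have e₂ : Real.exp (-(c * t)) * Real.exp (c * (t - τ)) = Real.exp (-(c * τ)) := by
    rw [← Real.exp_add]; ring_nf
  simp only [Pi.sub_apply]
  linear_combination g t * e₁ - g (t - τ) * e₂

/-- Derivative of the double integral of an exponentially weighted function. -/
theorem hasDerivAt_integral_integral_exp_window {g : ℝ → ℝ} (hg : Continuous g) (c τ t : ℝ) :
    HasDerivAt
      (fun u => ∫ θ in (-τ)..(0 : ℝ), ∫ s in (u + θ)..u, Real.exp (c * (s - u)) * g s)
      (τ * g t - (∫ s in (t - τ)..t, Real.exp (c * (s - t)) * g s) -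
        c * ∫ θ in (-τ)..(0 : ℝ), ∫ s in (t + θ)..t, Real.exp (c * (s - t)) * g s) t := by
  have hh : Continuous fun s => Real.exp (c * s) * g s := by fun_prop
  have hF (u : ℝ) := hh.integral_hasStrictDerivAt 0 u |>.hasDerivAt
  simp only [integral_exp_sub_mul_eq hg c]
  set F : ℝ → ℝ := fun u => ∫ s in (0 : ℝ)..u, Real.exp (c * s) * g s with hFdef
  have hFc : Continuous F := continuous_iff_continuousAt.2 fun u => (hF u).continuousAt
  have hG (u : ℝ) := hFc.integral_hasStrictDerivAt 0 u |>.hasDerivAt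
  have hdouble (u : ℝ) :
      ∫ θ in (-τ)..(0 : ℝ), Real.exp (-(c * u)) * (F u - F (u + θ)) =
        Real.exp (-(c * u)) *
          (τ * F u - ((∫ r in (0 : ℝ)..u, F r) - ∫ r in (0 : ℝ)..(u - τ), F r)) := by
    have hs : Continuous fun θ => F (u + θ) := by fun_prop
    rw [intervalIntegral.integral_const_mul,
      intervalIntegral.integral_sub (by simp) (hs.intervalIntegrable _ _),
      intervalIntegral.integral_comp_add_left F u,
      intervalIntegral.integral_interval_sub_left (hFc.intervalIntegrable _ _)
        (hFc.intervalIntegrable _ _)]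
    simp [sub_eq_add_neg]
  have key := (hasDerivAt_exp_neg_mul c t).mul
    (((hF t).const_mul τ).sub ((hG t).sub ((hG (t - τ)).comp_sub_const t τ)))
  change HasDerivAt (fun u => ∫ θ in (-τ)..(0 : ℝ), Real.exp (-(c * u)) * (F u - F (u + θ)))
    (τ * g t - Real.exp (-(c * t)) * (F t - F (t - τ)) -
      c * ∫ θ in (-τ)..(0 : ℝ), Real.exp (-(c * t)) * (F t - F (t + θ))) t
  simp only [hdouble]
  refine key.congr_deriv ?_
  have e₁ : Real.exp (-(c * t)) * Real.exp (c * t) = 1 := by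
    rw [← Real.exp_add]; simp
  simp only [Pi.sub_apply]
  linear_combination τ * g t * e₁

/-- Derivative of a symmetric quadratic form along a differentiable curve. -/
theorem Matrix.IsSymm.hasDerivAt_dotProduct_mulVec {ι : Type*} [Fintype ι]
    {P : Matrix ι ι ℝ} (hP : P.IsSymm) {x : ℝ → ι → ℝ} {v : ι → ℝ} {t : ℝ}
    (hx : HasDerivAt x v t) :
    HasDerivAt (fun u => x u ⬝ᵥ (P *ᵥ x u)) (2 * (x t ⬝ᵥ (P *ᵥ v))) t := by
  have hi := hasDerivAt_pi.1 hx
  have hPx (i : ι) : HasDerivAt (fun u => (P *ᵥ x u) i) ((P *ᵥ v) i) t :=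
    HasDerivAt.fun_sum fun j _ => (hi j).const_mul (P i j)
  have key : HasDerivAt (fun u => x u ⬝ᵥ (P *ᵥ x u))
      (∑ i, (v i * (P *ᵥ x t) i + x t i * (P *ᵥ v) i)) t :=
    HasDerivAt.fun_sum fun i _ => (hi i).mul (hPx i)
  refine key.congr_deriv ?_
  have hsymm : v ⬝ᵥ (P *ᵥ x t) = x t ⬝ᵥ (P *ᵥ v) := by
    rw [dotProduct_mulVec, ← mulVec_transpose, hP.eq, dotProduct_comm]
  rw [Finset.sum_add_distrib, two_mul]
  exact congrArg (· + x t ⬝ᵥ (P *ᵥ v)) hsymm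

/-- Derivative of the Lyapunov–Krasovskii functional: with
`V(t) = x(t)ᵀPx(t) + ∫_{t−τ}^t e^{2α(s−t)} x(s)ᵀQx(s) ds
      + τ ∫_{−τ}^0 ∫_{t+θ}^t e^{2α(s−t)} x'(s)ᵀRx'(s) ds dθ`,
`V` is differentiable and
`V'(t) + 2αV(t) = 2x(t)ᵀPx'(t) + x(t)ᵀ(2αP+Q)x(t) + τ²x'(t)ᵀRx'(t)
  − e^{−2ατ} x(t−τ)ᵀQx(t−τ) − τ ∫_{t−τ}^t e^{2α(s−t)} x'(s)ᵀRx'(s) ds`. -/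
theorem stmt_13 (n : ℕ) (hn : 0 < n) (α τ : ℝ) (hτ : 0 < τ)
    (P Q R : Matrix (Fin n) (Fin n) ℝ)
    (hP : P.IsSymm) (hQ : Q.IsSymm) (hR : R.IsSymm)
    (x x' : ℝ → (Fin n → ℝ)) (hx : ∀ t, HasDerivAt x (x' t) t)
    (hx' : Continuous x')
    (V : ℝ → ℝ)
    (hV : ∀ t, V t = x t ⬝ᵥ (P *ᵥ x t) +
      (∫ s in (t - τ)..t, Real.exp (2 * α * (s - t)) * (x s ⬝ᵥ (Q *ᵥ x s))) +
      τ * ∫ θ in (-τ)..(0:ℝ), ∫ s in (t + θ)..t,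
        Real.exp (2 * α * (s - t)) * (x' s ⬝ᵥ (R *ᵥ x' s))) :
    ∀ t, DifferentiableAt ℝ V t ∧
      deriv V t + 2 * α * V t =
        2 * (x t ⬝ᵥ (P *ᵥ x' t)) + x t ⬝ᵥ (((2 * α) • P + Q) *ᵥ x t) +
          τ ^ 2 * (x' t ⬝ᵥ (R *ᵥ x' t)) -
          Real.exp (-(2 * α * τ)) * (x (t - τ) ⬝ᵥ (Q *ᵥ x (t - τ))) -
          τ * ∫ s in (t - τ)..t,
            Real.exp (2 * α * (s - t)) * (x' s ⬝ᵥ (R *ᵥ x' s)) := by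
  intro t
  have hxc : Continuous x := continuous_iff_continuousAt.2 fun u => (hx u).continuousAt
  have hqQ : Continuous fun s => x s ⬝ᵥ (Q *ᵥ x s) :=
    hxc.dotProduct (continuous_const.matrix_mulVec hxc)
  have hqR : Continuous fun s => x' s ⬝ᵥ (R *ᵥ x' s) :=
    hx'.dotProduct (continuous_const.matrix_mulVec hx')
  have hVd := ((hP.hasDerivAt_dotProduct_mulVec (hx t)).add
    (hasDerivAt_integral_exp_window hqQ (2 * α) τ t)).add
    ((hasDerivAt_integral_integral_exp_window hqR (2 * α) τ t).const_mul τ)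
  replace hVd := hVd.congr_of_eventuallyEq (f₁ := V) (.of_forall hV)
  refine ⟨hVd.differentiableAt, ?_⟩
  rw [hVd.deriv, hV t, add_mulVec, smul_mulVec, dotProduct_add, dotProduct_smul, smul_eq_mul]
  ring
end
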